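/- arXiv:2305.01284 — 6 statements merged into one kernel-verified Lean document; each statement's English description precedes it below -/
import Mathlib

section
/- Let ℓ and n be integers with 1 ≤ n ≤ ℓ. Let ξ : Fin ℓ → ℝ satisfy ∑_m ξ_m² = 1, and let A : Finset (Fin ℓ) → ℝ satisfy A(I) = 0 whenever I.card ≠ n, together with ∑_I A(I)² = 1. Then ∑_{I' : I'.card = n−1} ( ∑_{m ∉ I'} A(insert m I') · ξ_m )² ≤ (n / ℓ) · (ℓ − n + 1). -/
/-- Double counting: pairs (I', m) with m outside I' versus pairs (I, m) with m in I. -/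
theorem pseudo_swap (ℓ n : ℕ) (hn : 1 ≤ n) (f : Finset (Fin ℓ) → Fin ℓ → ℝ) :
    ∑ I' ∈ Finset.univ.filter (fun I' : Finset (Fin ℓ) => I'.card = n - 1),
      ∑ m ∈ I'ᶜ, f (insert m I') m
    = ∑ I ∈ Finset.univ.filter (fun I : Finset (Fin ℓ) => I.card = n), ∑ m ∈ I, f I m := by
  rw [Finset.sum_sigma', Finset.sum_sigma']
  refine Finset.sum_bij' (fun p _ => ⟨insert p.2 p.1, p.2⟩) (fun p _ => ⟨p.1.erase p.2, p.2⟩)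
    ?_ ?_ ?_ ?_ ?_
  · rintro ⟨I, m⟩ h
    simp only [Finset.mem_sigma, Finset.mem_filter, Finset.mem_univ, true_and,
      Finset.mem_compl] at h ⊢
    rw [Finset.card_insert_of_notMem h.2]
    exact ⟨by omega, Finset.mem_insert_self _ _⟩
  · rintro ⟨I, m⟩ h
    simp only [Finset.mem_sigma, Finset.mem_filter, Finset.mem_univ, true_and,
      Finset.mem_compl] at h ⊢
    rw [Finset.card_erase_of_mem h.2]
    exact ⟨by omega, Finset.notMem_erase _ _⟩
  · rintro ⟨I, m⟩ h
    simp only [Finset.mem_sigma, Finset.mem_compl] at h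
    simp [Finset.erase_insert h.2]
  · rintro ⟨I, m⟩ h
    simp only [Finset.mem_sigma] at h
    simp [Finset.insert_erase h.2]
  · intros
    rfl

/-- Theorem 1 of the paper (even particle number `N = 2n`): universal upper bound on the
expectation `⟨Ψ| b_ξ† b_ξ |Ψ⟩` of a pseudoprojector in the hard-core-boson picture. -/
theorem pseudoprojector_norm_bound_even (ℓ n : ℕ) (hn : 1 ≤ n) (hnℓ : n ≤ ℓ)
    (ξ : Fin ℓ → ℝ) (hξ : ∑ m, ξ m ^ 2 = 1)
    (A : Finset (Fin ℓ) → ℝ)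
    (hA0 : ∀ I : Finset (Fin ℓ), I.card ≠ n → A I = 0)
    (hA1 : ∑ I : Finset (Fin ℓ), A I ^ 2 = 1) :
    ∑ I' ∈ Finset.univ.filter (fun I' : Finset (Fin ℓ) => I'.card = n - 1),
        (∑ m ∈ I'ᶜ, A (insert m I') * ξ m) ^ 2
      ≤ ((n : ℝ) / ℓ) * ((ℓ : ℝ) - n + 1) := by
  have hn' : (1 : ℝ) ≤ n := by exact_mod_cast hn
  have hl' : (n : ℝ) ≤ ℓ := by exact_mod_cast hnℓ
  have hl0 : (0 : ℝ) < ℓ := by linarith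
  set c : ℝ := (ℓ : ℝ) - n + 1 with hc
  have hc0 : 0 < c := by linarith
  let f : Finset (Fin ℓ) → Fin ℓ → ℝ := fun I m =>
    A I ^ 2 * (c * ((n - 1) * ξ m ^ 2 + (1 - (∑ j ∈ I, ξ j ^ 2 - ξ m ^ 2))))
  have key : ∀ I' ∈ Finset.univ.filter (fun I' : Finset (Fin ℓ) => I'.card = n - 1),
      (ℓ : ℝ) * (∑ m ∈ I'ᶜ, A (insert m I') * ξ m) ^ 2 ≤ ∑ m ∈ I'ᶜ, f (insert m I') m := by
    intro I' hI
    simp only [Finset.mem_filter, Finset.mem_univ, true_and] at hI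
    have hcard : ((I'ᶜ).card : ℝ) = c := by
      rw [Finset.card_compl, Fintype.card_fin, hI, hc, Nat.cast_sub (by omega),
        Nat.cast_sub hn]
      push_cast
      ring
    have h1 := sq_sum_le_card_mul_sum_sq (s := I'ᶜ) (f := fun m => A (insert m I') * ξ m)
    rw [hcard] at h1
    have h2 := Finset.sum_mul_sq_le_sq_mul_sq I'ᶜ (fun m => A (insert m I')) ξ
    have hx : ∑ m ∈ I'ᶜ, ξ m ^ 2 = 1 - ∑ m ∈ I', ξ m ^ 2 := by
      rw [← hξ, ← Finset.sum_add_sum_compl I']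
      ring
    rw [hx] at h2
    have h3 : ∑ m ∈ I'ᶜ, f (insert m I') m
        = (n - 1) * (c * ∑ m ∈ I'ᶜ, (A (insert m I') * ξ m) ^ 2)
          + c * ((∑ m ∈ I'ᶜ, A (insert m I') ^ 2) * (1 - ∑ m ∈ I', ξ m ^ 2)) := by
      rw [Finset.sum_mul, Finset.mul_sum, Finset.mul_sum, Finset.mul_sum,
        ← Finset.sum_add_distrib]
      refine Finset.sum_congr rfl fun m hm => ?_
      simp only [f]
      rw [Finset.sum_insert (Finset.mem_compl.1 hm)]
      ring
    rw [h3]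
    have h4 := mul_le_mul_of_nonneg_left h1 (by linarith : (0 : ℝ) ≤ n - 1)
    have h5 := mul_le_mul_of_nonneg_left h2 hc0.le
    have h6 : (ℓ : ℝ) = (n - 1) + c := by rw [hc]; ring
    rw [h6, add_mul]
    exact add_le_add h4 h5
  have tot := Finset.sum_le_sum key
  rw [← Finset.mul_sum, pseudo_swap ℓ n hn f] at tot
  have hR : ∑ I ∈ Finset.univ.filter (fun I : Finset (Fin ℓ) => I.card = n), ∑ m ∈ I, f I m
      = c * n := by
    have : ∀ I ∈ Finset.univ.filter (fun I : Finset (Fin ℓ) => I.card = n),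
        ∑ m ∈ I, f I m = A I ^ 2 * (c * n) := by
      intro I hI
      simp only [Finset.mem_filter, Finset.mem_univ, true_and] at hI
      simp only [f]
      rw [← Finset.mul_sum, ← Finset.mul_sum, Finset.sum_add_distrib, Finset.sum_sub_distrib,
        Finset.sum_sub_distrib, ← Finset.mul_sum]
      simp only [Finset.sum_const, hI, nsmul_eq_mul]
      ring
    rw [Finset.sum_congr rfl this, ← Finset.sum_mul, Finset.sum_filter_of_ne, hA1, one_mul]
    intro I _ h
    by_contra h'
    exact h (by rw [hA0 I h']; ring)
  rw [hR] at tot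
  rw [div_mul_eq_mul_div, le_div_iff₀ hl0]
  linarith
end

section
/- Let ℓ and n be integers with ℓ ≥ 2 and 1 ≤ n ≤ ℓ − 1. Let ξ : Fin ℓ → ℝ satisfy ∑_m ξ_m² = 1, and let A : Finset (Fin ℓ) × Fin ℓ → ℝ satisfy A(I, i) = 0 unless (I.card = n and i ∉ I), together with ∑_{I, i} A(I, i)² = 1. Then ∑_{i} ∑_{I' : I'.card = n−1} ( ∑_{m ∉ I'} A(insert m I', i) · ξ_m )² ≤ n · (ℓ − n) / (ℓ − 1). -/
open Finset in
lemma sum_insert_powerset_eq {α : Type*} [DecidableEq α] (S : Finset α) (i : α) (hi : i ∈ S)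
    (f : Finset α → ℝ) :
    ∑ I ∈ (S.erase i).powerset, f (insert i I) = ∑ I ∈ S.powerset, if i ∈ I then f I else 0 := by
  conv_rhs => rw [← Finset.insert_erase hi]
  rw [Finset.sum_powerset_insert (Finset.notMem_erase i S)]
  have h1 : ∑ t ∈ (S.erase i).powerset, (if i ∈ t then f t else 0) = 0 := by
    apply Finset.sum_eq_zero
    intro t ht
    have : i ∉ t := fun h => Finset.notMem_erase i S (Finset.mem_powerset.1 ht h)
    simp [this]
  rw [h1, zero_add]
  simp

lemma sum_sum_insert_powerset {α : Type*} [DecidableEq α] (S : Finset α)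
    (f : Finset α → ℝ) :
    ∑ i ∈ S, ∑ I ∈ (S.erase i).powerset, f (insert i I)
      = ∑ I ∈ S.powerset, (I.card : ℝ) * f I := by
  rw [Finset.sum_congr rfl (fun i hi => sum_insert_powerset_eq S i hi f), Finset.sum_comm]
  apply Finset.sum_congr rfl
  intro I hI
  rw [← Finset.sum_filter, Finset.sum_const, nsmul_eq_mul, Finset.filter_mem_eq_inter,
    Finset.inter_eq_right.2 (Finset.mem_powerset.1 hI)]

lemma sum_powerset_split {α : Type*} [DecidableEq α] (S : Finset α) (i : α) (hi : i ∈ S)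
    (f : Finset α → ℝ) :
    ∑ I ∈ S.powerset, f I = ∑ I ∈ (S.erase i).powerset, f I
      + ∑ I ∈ (S.erase i).powerset, f (insert i I) := by
  conv_lhs => rw [← Finset.insert_erase hi]
  rw [Finset.sum_powerset_insert (Finset.notMem_erase i S)]

lemma two_mul_le_of_sq_le {z p q : ℝ} (hp : 0 ≤ p) (hq : 0 ≤ q) (h : z ^ 2 ≤ 4 * (p * q)) :
    z ≤ p + q := by
  apply le_of_sq_le_sq ?_ (by positivity) |> fun h => h
  nlinarith [sq_nonneg (p - q)]

/-- the one-site inequality -/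
lemma site_ineq (d k x y u v X Y Z : ℝ) (hk : 0 ≤ k) (hd1 : 1 ≤ d) (hd : k + 1 ≤ d)
    (hx : 0 ≤ x) (hy : 0 ≤ y) (hu : 0 ≤ u) (hv : 0 ≤ v)
    (hX0 : 0 ≤ X) (hY0 : 0 ≤ Y)
    (hX : (d - 1) * X ≤ (k + 1) * (d - 1 - k) * (x * y))
    (hY : (d - 1) * Y ≤ k * (d - k) * (u * v)) (hZ : Z ^ 2 ≤ X * Y) :
    d ^ 2 * ((d - 1) * (X + Y + 2 * Z)) ≤
      d ^ 2 * ((k + 1) * (d - 1 - k) * (x * y) + k * (d - k) * (u * v))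
      + (k * (k + 1) * (x * y) + (d - 1 - k) * (d - k) * (u * v))
      + (d ^ 2 - 1) * (k * (d - 1 - k) * (u * y) + (k + 1) * (d - k) * (x * v)) := by
  have e1 : 0 ≤ d - 1 - k := by linarith
  have e2 : 0 ≤ d - k := by linarith
  have e3 : 0 ≤ d - 1 := by linarith
  have hprod : ((d - 1) * X) * ((d - 1) * Y) ≤
      ((k + 1) * (d - 1 - k) * (x * y)) * (k * (d - k) * (u * v)) :=
    mul_le_mul hX hY (by positivity) (by positivity)
  have hR : (2 * ((d - 1) * Z)) ^ 2 ≤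
      4 * (((k + 1) * (d - 1 - k) * (x * y)) * (k * (d - k) * (u * v))) := by
    have := mul_le_mul_of_nonneg_left hZ (sq_nonneg (d - 1))
    nlinarith
  have r1 : 2 * ((d - 1) * Z) ≤ k * (k + 1) * (x * y) + (d - 1 - k) * (d - k) * (u * v) := by
    apply two_mul_le_of_sq_le (by positivity) (by positivity)
    refine hR.trans (le_of_eq (by ring))
  have r2 : 2 * ((d - 1) * Z) ≤ k * (d - 1 - k) * (u * y) + (k + 1) * (d - k) * (x * v) := by
    apply two_mul_le_of_sq_le (by positivity) (by positivity)
    refine hR.trans (le_of_eq (by ring))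
  have e4 : 0 ≤ d ^ 2 - 1 := by nlinarith
  have := mul_le_mul_of_nonneg_left r2 e4
  have h2 := mul_le_mul_of_nonneg_left (add_le_add hX hY) (sq_nonneg d)
  nlinarith

/-- transition amplitude -/
noncomputable def amp {α : Type*} [DecidableEq α] (S : Finset α) (A B : Finset α → ℝ) (m : α) : ℝ :=
  ∑ I ∈ (S.erase m).powerset, A (insert m I) * B I

lemma amp_split {α : Type*} [DecidableEq α] (S : Finset α) (A B : Finset α → ℝ) (m i : α)
    (hi : i ∈ S) (hmi : m ≠ i) :
    amp S A B m = amp (S.erase i) A B m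
      + amp (S.erase i) (fun I => A (insert i I)) (fun I => B (insert i I)) m := by
  unfold amp
  rw [sum_powerset_split (S.erase m) i (Finset.mem_erase.2 ⟨hmi.symm, hi⟩),
    Finset.erase_right_comm (a := m) (b := i)]
  simp only [Finset.insert_comm m i]

lemma amp_bound {α : Type*} [DecidableEq α] (d : ℕ) : ∀ (S : Finset α) (k : ℕ)
    (A B : Finset α → ℝ), S.card = d → k ≤ d →
    (∀ I ⊆ S, I.card ≠ k + 1 → A I = 0) → (∀ I ⊆ S, I.card ≠ k → B I = 0) →
    (d : ℝ) * ∑ m ∈ S, amp S A B m ^ 2 ≤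
      ((k : ℝ) + 1) * ((d : ℝ) - k) *
        ((∑ I ∈ S.powerset, A I ^ 2) * (∑ I ∈ S.powerset, B I ^ 2)) := by
  induction d with
  | zero =>
    intro S k A B hS hk hA hB
    obtain rfl : k = 0 := by omega
    simp
  | succ e ih =>
    intro S k A B hS hk hA hB
    have hP0 : 0 ≤ ∑ I ∈ S.powerset, A I ^ 2 := Finset.sum_nonneg fun _ _ => sq_nonneg _
    have hQ0 : 0 ≤ ∑ I ∈ S.powerset, B I ^ 2 := Finset.sum_nonneg fun _ _ => sq_nonneg _
    have hkd : (k : ℝ) ≤ (e + 1 : ℕ) := by exact_mod_cast hk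
    rcases Nat.lt_or_ge e k with hek | hek
    · have hz : ∀ m ∈ S, amp S A B m ^ 2 = 0 := by
        intro m hm
        have : amp S A B m = 0 := by
          unfold amp
          apply Finset.sum_eq_zero
          intro I hI
          have hI' := Finset.mem_powerset.1 hI
          have hc := Finset.card_le_card hI'
          rw [Finset.card_erase_of_mem hm, hS] at hc
          rw [hB I (hI'.trans (Finset.erase_subset _ _)) (by omega), mul_zero]
        simp [this]
      rw [Finset.sum_eq_zero hz, mul_zero]
      exact mul_nonneg (mul_nonneg (by positivity) (by linarith)) (mul_nonneg hP0 hQ0)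
    rcases Nat.eq_zero_or_pos e with he | he
    · subst he
      obtain rfl : k = 0 := by omega
      obtain ⟨a, rfl⟩ := Finset.card_eq_one.1 hS
      have hp : ({a} : Finset α).powerset = {∅, {a}} := by
        ext t; simp [Finset.subset_singleton_iff]
      have hne : (∅ : Finset α) ≠ {a} := (Finset.singleton_ne_empty a).symm
      have h1 : A ∅ = 0 := hA ∅ (by simp) (by simp)
      have h2 : B {a} = 0 := hB {a} (by simp) (by simp)
      rw [hp, Finset.sum_pair hne, Finset.sum_pair hne, h1, h2]
      simp [amp, mul_pow]
    -- main case
    set P := ∑ I ∈ S.powerset, A I ^ 2 with hP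
    set Q := ∑ I ∈ S.powerset, B I ^ 2 with hQ
    set C := ∑ m ∈ S, amp S A B m ^ 2 with hC
    set u : α → ℝ := fun i => ∑ I ∈ (S.erase i).powerset, A (insert i I) ^ 2 with hu
    set v : α → ℝ := fun i => ∑ I ∈ (S.erase i).powerset, B (insert i I) ^ 2 with hv
    have hsu : ∑ i ∈ S, u i = (k + 1) * P := by
      rw [hu, sum_sum_insert_powerset S (fun I => A I ^ 2), hP, Finset.mul_sum]
      apply Finset.sum_congr rfl
      intro I hI
      by_cases h : I.card = k + 1
      · rw [h]; push_cast; ring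
      · rw [hA I (Finset.mem_powerset.1 hI) h]; simp
    have hsv : ∑ i ∈ S, v i = k * Q := by
      rw [hv, sum_sum_insert_powerset S (fun I => B I ^ 2), hQ, Finset.mul_sum]
      apply Finset.sum_congr rfl
      intro I hI
      by_cases h : I.card = k
      · rw [h]
      · rw [hB I (Finset.mem_powerset.1 hI) h]; simp
    have hsite : ∀ i ∈ S, ((e : ℝ) + 1) ^ 2 * ((e : ℝ) * (C - amp S A B i ^ 2)) ≤
        ((e : ℝ) + 1) ^ 2 * ((k + 1) * (e - k) * ((P - u i) * (Q - v i))
          + k * (e + 1 - k) * (u i * v i))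
        + (k * (k + 1) * ((P - u i) * (Q - v i)) + (e - k) * (e + 1 - k) * (u i * v i))
        + (((e : ℝ) + 1) ^ 2 - 1) * (k * (e - k) * (u i * (Q - v i))
          + (k + 1) * (e + 1 - k) * ((P - u i) * v i)) := by
      intro i hi
      have hcard : (S.erase i).card = e := by rw [Finset.card_erase_of_mem hi, hS]; rfl
      have hPs : P - u i = ∑ I ∈ (S.erase i).powerset, A I ^ 2 := by
        rw [hP, sum_powerset_split S i hi]; simp [hu]
      have hQs : Q - v i = ∑ I ∈ (S.erase i).powerset, B I ^ 2 := by
        rw [hQ, sum_powerset_split S i hi]; simp [hv]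
      have hsub : ∀ I ⊆ S.erase i, I ⊆ S := fun I h => h.trans (Finset.erase_subset _ _)
      have hins : ∀ I ⊆ S.erase i, insert i I ⊆ S ∧ (insert i I).card = I.card + 1 := by
        intro I h
        refine ⟨Finset.insert_subset hi (hsub I h), Finset.card_insert_of_notMem ?_⟩
        exact fun h' => Finset.notMem_erase i S (h h')
      have i0 := ih (S.erase i) k A B hcard hek (fun I h => hA I (hsub I h))
        (fun I h => hB I (hsub I h))
      have i1 : (e : ℝ) * ∑ m ∈ S.erase i, amp (S.erase i) (fun I => A (insert i I))
          (fun I => B (insert i I)) m ^ 2 ≤ k * (e + 1 - k) * (u i * v i) := by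
        rcases Nat.eq_zero_or_pos k with hk0 | hk0
        · subst hk0
          have hz : ∀ m ∈ S.erase i, amp (S.erase i) (fun I => A (insert i I))
              (fun I => B (insert i I)) m ^ 2 = 0 := by
            intro m hm
            have : amp (S.erase i) (fun I => A (insert i I))
              (fun I => B (insert i I)) m = 0 := by
              unfold amp
              apply Finset.sum_eq_zero
              intro I hI
              have h := (Finset.mem_powerset.1 hI).trans (Finset.erase_subset _ _)
              have := hB _ (hins I h).1 (by rw [(hins I h).2]; omega)
              simp [this]
            simp [this]
          rw [Finset.sum_eq_zero hz]
          simp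
        · obtain ⟨j, rfl⟩ : ∃ j, k = j + 1 := ⟨k - 1, by omega⟩
          have := ih (S.erase i) j (fun I => A (insert i I)) (fun I => B (insert i I)) hcard
            (by omega)
            (fun I h h' => hA _ (hins I h).1 (by rw [(hins I h).2]; omega))
            (fun I h h' => hB _ (hins I h).1 (by rw [(hins I h).2]; omega))
          refine this.trans (le_of_eq ?_)
          simp only [hu, hv]
          push_cast
          ring
      rw [← hPs, ← hQs] at i0
      have hcs := Finset.sum_mul_sq_le_sq_mul_sq (S.erase i) (amp (S.erase i) A B)
        (amp (S.erase i) (fun I => A (insert i I)) (fun I => B (insert i I)))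
      have hCi : C - amp S A B i ^ 2 = ∑ m ∈ S.erase i, amp (S.erase i) A B m ^ 2
          + ∑ m ∈ S.erase i, amp (S.erase i) (fun I => A (insert i I))
            (fun I => B (insert i I)) m ^ 2
          + 2 * ∑ m ∈ S.erase i, amp (S.erase i) A B m * amp (S.erase i)
            (fun I => A (insert i I)) (fun I => B (insert i I)) m := by
        rw [hC, ← Finset.add_sum_erase S _ hi, add_sub_cancel_left, Finset.mul_sum,
          ← Finset.sum_add_distrib, ← Finset.sum_add_distrib]
        apply Finset.sum_congr rfl
        intro m hm
        rw [amp_split S A B m i hi (Finset.ne_of_mem_erase hm)]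
        ring
      have hke : (k : ℝ) ≤ e := by exact_mod_cast hek
      have key := site_ineq ((e : ℝ) + 1) k (P - u i) (Q - v i) (u i) (v i) _ _ _
        (by positivity) (by linarith [(Nat.cast_nonneg e : (0:ℝ) ≤ e)]) (by linarith)
        (by rw [hPs]; exact Finset.sum_nonneg fun _ _ => sq_nonneg _)
        (by rw [hQs]; exact Finset.sum_nonneg fun _ _ => sq_nonneg _)
        (Finset.sum_nonneg fun _ _ => sq_nonneg _)
        (Finset.sum_nonneg fun _ _ => sq_nonneg _)
        (Finset.sum_nonneg fun _ _ => sq_nonneg _)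
        (Finset.sum_nonneg fun _ _ => sq_nonneg _)
        (by simpa only [add_sub_cancel_right] using i0)
        (by simpa only [add_sub_cancel_right] using i1) hcs
      rw [← hCi] at key
      simpa only [add_sub_cancel_right] using key
    have hlin : ∀ i ∈ S, ((e : ℝ) + 1) ^ 2 * ((e : ℝ) * (C - amp S A B i ^ 2)) ≤
        (((e : ℝ) + 1) ^ 2 * ((k + 1) * (e - k)) + k * (k + 1)) * (P * Q)
        + (-(((e : ℝ) + 1) ^ 2 * ((k + 1) * (e - k)) + k * (k + 1))
            + (((e : ℝ) + 1) ^ 2 - 1) * (k * (e - k))) * Q * u i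
        + (-(((e : ℝ) + 1) ^ 2 * ((k + 1) * (e - k)) + k * (k + 1))
            + (((e : ℝ) + 1) ^ 2 - 1) * ((k + 1) * (e + 1 - k))) * P * v i := by
      intro i hi
      refine (hsite i hi).trans (le_of_eq ?_)
      ring
    have hsum := Finset.sum_le_sum hlin
    rw [Finset.sum_add_distrib, Finset.sum_add_distrib, ← Finset.mul_sum, ← Finset.mul_sum,
      ← Finset.mul_sum, ← Finset.mul_sum, ← Finset.mul_sum, ← Finset.mul_sum, hsu, hsv, Finset.sum_sub_distrib, ← hC,
      Finset.sum_const, Finset.sum_const, hS, nsmul_eq_mul, nsmul_eq_mul] at hsum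
    push_cast at hsum ⊢
    have he' : (0 : ℝ) < e := by exact_mod_cast he
    have hpos : (0 : ℝ) < ((e : ℝ) + 1) * (e : ℝ) ^ 2 := by positivity
    refine le_of_mul_le_mul_left ?_ hpos
    refine (le_of_eq ?_).trans (hsum.trans (le_of_eq ?_))
    · ring
    · ring

lemma even_bound {α : Type*} [DecidableEq α] (S : Finset α) (k : ℕ) (hk : k ≤ S.card)
    (A : Finset α → ℝ) (ξ : α → ℝ) (hA : ∀ I ⊆ S, I.card ≠ k + 1 → A I = 0)
    (hξ : ∑ m ∈ S, ξ m ^ 2 ≤ 1) :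
    (S.card : ℝ) * ∑ I ∈ S.powerset with I.card = k, (∑ m ∈ S \ I, A (insert m I) * ξ m) ^ 2
      ≤ ((k : ℝ) + 1) * ((S.card : ℝ) - k) * ∑ I ∈ S.powerset, A I ^ 2 := by
  set B : Finset α → ℝ := fun I => if I.card = k then ∑ m ∈ S \ I, A (insert m I) * ξ m else 0
    with hB
  have hX : ∑ I ∈ S.powerset with I.card = k, (∑ m ∈ S \ I, A (insert m I) * ξ m) ^ 2
      = ∑ I ∈ S.powerset, B I ^ 2 := by
    rw [Finset.sum_filter]
    apply Finset.sum_congr rfl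
    intro I _
    by_cases h : I.card = k <;> simp [hB, h]
  have hX2 : ∑ I ∈ S.powerset, B I ^ 2 = ∑ m ∈ S, ξ m * amp S A B m := by
    have h1 : ∀ I ∈ S.powerset, B I ^ 2 =
        ∑ m ∈ S, if m ∉ I then ξ m * (A (insert m I) * B I) else 0 := by
      intro I _
      rw [← Finset.sum_filter]
      have : S.filter (fun m => m ∉ I) = S \ I := by ext; simp
      rw [this]
      by_cases h : I.card = k
      · have hb : B I = ∑ m ∈ S \ I, A (insert m I) * ξ m := by simp [hB, h]
        rw [sq]
        nth_rewrite 1 [hb]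
        rw [Finset.sum_mul]
        exact Finset.sum_congr rfl fun _ _ => by ring
      · have hb : B I = 0 := by simp [hB, h]
        simp [hb]
    rw [Finset.sum_congr rfl h1, Finset.sum_comm]
    apply Finset.sum_congr rfl
    intro m hm
    rw [amp, Finset.mul_sum, ← Finset.sum_filter]
    apply Finset.sum_congr _ fun _ _ => rfl
    ext I
    simp [Finset.subset_erase]
  have hb := amp_bound S.card S k A B rfl hk hA (fun I _ h => by simp [hB, h])
  rw [hX]
  set X := ∑ I ∈ S.powerset, B I ^ 2 with hXd
  have hcs := Finset.sum_mul_sq_le_sq_mul_sq S ξ (amp S A B)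
  rw [← hX2] at hcs
  have hX0 : 0 ≤ X := Finset.sum_nonneg fun _ _ => sq_nonneg _
  have hC0 : 0 ≤ ∑ m ∈ S, amp S A B m ^ 2 := Finset.sum_nonneg fun _ _ => sq_nonneg _
  have hP0 : 0 ≤ ∑ I ∈ S.powerset, A I ^ 2 := Finset.sum_nonneg fun _ _ => sq_nonneg _
  have hkS : (0 : ℝ) ≤ (S.card : ℝ) - k := sub_nonneg.2 (by exact_mod_cast hk)
  have h3 : X ^ 2 ≤ ∑ m ∈ S, amp S A B m ^ 2 := hcs.trans (by nlinarith)
  rcases hX0.eq_or_lt with h0 | h0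
  · rw [← h0, mul_zero]; positivity
  · refine le_of_mul_le_mul_right ?_ h0
    have := mul_le_mul_of_nonneg_left h3 (Nat.cast_nonneg (α := ℝ) S.card)
    nlinarith

/-- Theorem 2 of the paper (odd particle number `N = 2n + 1`): universal upper bound on the
expectation `⟨Ψ| b_ξ† b_ξ |Ψ⟩` of a pseudoprojector in the hard-core-boson picture, with one
unpaired fermion at pair index `i ∉ I`. -/
theorem pseudoprojector_norm_bound_odd (ℓ n : ℕ) (hℓ : 2 ≤ ℓ) (hn : 1 ≤ n) (hnℓ : n ≤ ℓ - 1)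
    (ξ : Fin ℓ → ℝ) (hξ : ∑ m, ξ m ^ 2 = 1)
    (A : Finset (Fin ℓ) × Fin ℓ → ℝ)
    (hA0 : ∀ (I : Finset (Fin ℓ)) (i : Fin ℓ), ¬ (I.card = n ∧ i ∉ I) → A (I, i) = 0)
    (hA1 : ∑ p : Finset (Fin ℓ) × Fin ℓ, A p ^ 2 = 1) :
    ∑ i : Fin ℓ, ∑ I' ∈ Finset.univ.filter (fun I' : Finset (Fin ℓ) => I'.card = n - 1),
        (∑ m ∈ I'ᶜ, A (insert m I', i) * ξ m) ^ 2
      ≤ (n : ℝ) * ((ℓ : ℝ) - n) / ((ℓ : ℝ) - 1) := by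
  have hsite : ∀ i : Fin ℓ,
      ((ℓ : ℝ) - 1) * ∑ I' ∈ Finset.univ.filter (fun I' : Finset (Fin ℓ) => I'.card = n - 1),
        (∑ m ∈ I'ᶜ, A (insert m I', i) * ξ m) ^ 2
      ≤ (n : ℝ) * ((ℓ : ℝ) - n) * ∑ I : Finset (Fin ℓ), A (I, i) ^ 2 := by
    intro i
    have hc : (Finset.univ.erase i).card = ℓ - 1 := by
      rw [Finset.card_erase_of_mem (Finset.mem_univ i)]; simp
    have hξ' : ∑ m ∈ Finset.univ.erase i, ξ m ^ 2 ≤ 1 := by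
      rw [← hξ]
      exact Finset.sum_le_sum_of_subset_of_nonneg (Finset.erase_subset _ _)
        fun _ _ _ => sq_nonneg _
    have h := even_bound (Finset.univ.erase i) (n - 1) (by omega) (fun I => A (I, i)) ξ
      (fun I _ h => hA0 I i (fun h' => h (by omega))) hξ'
    rw [hc] at h
    have c1 : ((ℓ - 1 : ℕ) : ℝ) = (ℓ : ℝ) - 1 := by
      rw [Nat.cast_sub (by omega)]; simp
    have c2 : ((n - 1 : ℕ) : ℝ) = (n : ℝ) - 1 := by
      rw [Nat.cast_sub hn]; simp
    rw [c1, c2] at h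
    have hl : ∑ I' ∈ Finset.univ.filter (fun I' : Finset (Fin ℓ) => I'.card = n - 1),
          (∑ m ∈ I'ᶜ, A (insert m I', i) * ξ m) ^ 2
        = ∑ I ∈ (Finset.univ.erase i).powerset with I.card = n - 1,
          (∑ m ∈ Finset.univ.erase i \ I, A (insert m I, i) * ξ m) ^ 2 := by
      symm
      rw [Finset.sum_congr rfl (g := fun I => (∑ m ∈ Iᶜ, A (insert m I, i) * ξ m) ^ 2)]
      · apply Finset.sum_subset
        · intro I hI
          simp only [Finset.mem_filter] at hI ⊢
          exact ⟨Finset.mem_univ _, hI.2⟩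
        · intro I hI hI'
          have hiI : i ∈ I := by
            by_contra hcon
            apply hI'
            simp only [Finset.mem_filter] at hI ⊢
            refine ⟨?_, hI.2⟩
            rw [Finset.mem_powerset, Finset.subset_erase]
            exact ⟨Finset.subset_univ _, hcon⟩
          rw [Finset.sum_eq_zero]
          · simp
          · intro m _
            rw [hA0 _ i (fun h' => h'.2 (Finset.mem_insert_of_mem hiI)), zero_mul]
      · intro I _
        congr 1
        apply Finset.sum_subset
        · intro m hm
          rw [Finset.mem_sdiff] at hm
          exact Finset.mem_compl.2 hm.2
        · intro m hm hm'
          have hmi : m = i := by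
            by_contra hcon
            exact hm' (Finset.mem_sdiff.2 ⟨Finset.mem_erase.2 ⟨hcon, Finset.mem_univ _⟩,
              Finset.mem_compl.1 hm⟩)
          subst hmi
          rw [hA0 _ m (fun h' => h'.2 (Finset.mem_insert_self _ _)), zero_mul]
    have hr : ∑ I ∈ (Finset.univ.erase i).powerset, A (I, i) ^ 2
        ≤ ∑ I : Finset (Fin ℓ), A (I, i) ^ 2 :=
      Finset.sum_le_sum_of_subset_of_nonneg (Finset.subset_univ _) fun _ _ _ => sq_nonneg _
    rw [hl]
    refine h.trans ?_
    have hnl : (0 : ℝ) ≤ (ℓ : ℝ) - n := sub_nonneg.2 (by exact_mod_cast (by omega : n ≤ ℓ))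
    have h2 := mul_le_mul_of_nonneg_left hr
      (mul_nonneg (Nat.cast_nonneg (α := ℝ) n) hnl)
    refine (le_of_eq ?_).trans h2
    ring
  have hl1 : (0 : ℝ) < (ℓ : ℝ) - 1 := by
    have : (2 : ℝ) ≤ ℓ := by exact_mod_cast hℓ
    linarith
  rw [le_div_iff₀ hl1, mul_comm, Finset.mul_sum]
  refine (Finset.sum_le_sum fun i _ => hsite i).trans (le_of_eq ?_)
  rw [← Finset.mul_sum]
  rw [Fintype.sum_prod_type_right] at hA1
  rw [hA1, mul_one]
end

section
/- Let ℓ and n be integers with 1 ≤ n ≤ ℓ. Define ξ : Fin ℓ → ℝ by ξ_m = 1/√ℓ for every m, and define A : Finset (Fin ℓ) → ℝ by A(I) = (choose ℓ n)^{−1/2} if I.card = n and A(I) = 0 otherwise. Then ∑_m ξ_m² = 1, ∑_I A(I)² = 1, and ∑_{I' : I'.card = n−1} ( ∑_{m ∉ I'} A(insert m I') · ξ_m )² = (n / ℓ) · (ℓ − n + 1). In particular the even-particle-number upper bound (n/ℓ)(ℓ − n + 1) is attained. -/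
/-- Even-`N` half of Theorem 3 of the paper: the bound `(n/ℓ)(ℓ − n + 1)` is attained by the
uniform pairing vector `ξ_m = 1/√ℓ` and the maximally symmetric state with uniform amplitudes
on all `n`-element sets of occupied pairs. -/
theorem pseudoprojector_norm_bound_even_tight (ℓ n : ℕ) (hn : 1 ≤ n) (hnℓ : n ≤ ℓ)
    (ξ : Fin ℓ → ℝ) (hξ : ∀ m, ξ m = 1 / Real.sqrt ℓ)
    (A : Finset (Fin ℓ) → ℝ)
    (hA : ∀ I : Finset (Fin ℓ),
      A I = if I.card = n then 1 / Real.sqrt (ℓ.choose n) else 0) :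
    (∑ m, ξ m ^ 2 = 1) ∧ (∑ I : Finset (Fin ℓ), A I ^ 2 = 1) ∧
      ∑ I' ∈ Finset.univ.filter (fun I' : Finset (Fin ℓ) => I'.card = n - 1),
          (∑ m ∈ I'ᶜ, A (insert m I') * ξ m) ^ 2
        = ((n : ℝ) / ℓ) * ((ℓ : ℝ) - n + 1) := by
  have hℓ : (0 : ℝ) < ℓ := by exact_mod_cast (by omega : 0 < ℓ)
  have hC : (0 : ℝ) < (ℓ.choose n : ℝ) := by exact_mod_cast Nat.choose_pos hnℓ
  have hcard : ∀ k : ℕ, (Finset.univ.filter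
      (fun I : Finset (Fin ℓ) => I.card = k)).card = ℓ.choose k := by
    intro k
    have h := Finset.card_powersetCard k (Finset.univ : Finset (Fin ℓ))
    rw [Finset.card_univ, Fintype.card_fin] at h
    rw [← h]
    congr 1
    ext I
    simp [Finset.mem_powersetCard]
  refine ⟨?_, ?_, ?_⟩
  · simp only [hξ, div_pow, Real.sq_sqrt hℓ.le, Finset.sum_const, Finset.card_univ,
      Fintype.card_fin, nsmul_eq_mul]
    field_simp
  · have h1 : ∀ I : Finset (Fin ℓ), A I ^ 2 =
        if I.card = n then 1 / (ℓ.choose n : ℝ) else 0 := by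
      intro I
      rw [hA]
      split_ifs
      · rw [div_pow, Real.sq_sqrt hC.le, one_pow]
      · simp
    simp only [h1]
    rw [← Finset.sum_filter, Finset.sum_const, hcard, nsmul_eq_mul]
    field_simp
  · obtain ⟨k, rfl⟩ : ∃ k, n = k + 1 := ⟨n - 1, by omega⟩
    have hterm : ∀ I' ∈ Finset.univ.filter
        (fun I' : Finset (Fin ℓ) => I'.card = k + 1 - 1),
        (∑ m ∈ I'ᶜ, A (insert m I') * ξ m) ^ 2
          = ((ℓ : ℝ) - k) ^ 2 / ((ℓ.choose (k + 1) : ℝ) * ℓ) := by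
      intro I' hI
      have hI' : I'.card = k := by simpa using hI
      have hs : ∀ m ∈ I'ᶜ, A (insert m I') * ξ m
          = 1 / Real.sqrt (ℓ.choose (k + 1)) * (1 / Real.sqrt ℓ) := by
        intro m hm
        have hm' : m ∉ I' := by simpa using hm
        rw [hA, hξ, Finset.card_insert_of_notMem hm', hI', if_pos rfl]
      rw [Finset.sum_congr rfl hs, Finset.sum_const, Finset.card_compl, Fintype.card_fin,
        hI', nsmul_eq_mul, Nat.cast_sub (by omega), mul_pow, mul_pow, div_pow, div_pow,
        Real.sq_sqrt hC.le, Real.sq_sqrt hℓ.le]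
      field_simp
    rw [Finset.sum_congr rfl hterm, Finset.sum_const, hcard, nsmul_eq_mul]
    have hrec : (ℓ.choose (k + 1) : ℝ) * (k + 1) = ℓ.choose k * ((ℓ : ℝ) - k) := by
      have h := Nat.choose_succ_right_eq ℓ k
      rw [← Nat.cast_sub (by omega : k ≤ ℓ)]
      exact_mod_cast h
    simp only [Nat.add_sub_cancel]
    push_cast
    field_simp
    linear_combination (-((ℓ : ℝ) - k)) * hrec
end

section
/- Let ℓ and n be integers with ℓ ≥ 2 and 1 ≤ n ≤ ℓ − 1, and fix i₀ ∈ Fin ℓ. Define ξ : Fin ℓ → ℝ by ξ_m = 1/√(ℓ−1) for m ≠ i₀ and ξ_{i₀} = 0, and define A : Finset (Fin ℓ) × Fin ℓ → ℝ by A(I, i₀) = (choose (ℓ−1) n)^{−1/2} if I.card = n and i₀ ∉ I, and A(I, i) = 0 in all other cases. Then ∑_m ξ_m² = 1, ∑_{I,i} A(I,i)² = 1, and ∑_{i} ∑_{I' : I'.card = n−1} ( ∑_{m ∉ I'} A(insert m I', i) · ξ_m )² = n · (ℓ − n) / (ℓ − 1). In particular the odd-particle-number upper bound n(ℓ − n)/(ℓ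 − 1) is attained. -/
theorem aux_card_filter (k n : ℕ) (i₀ : Fin (k + 1)) :
    (Finset.univ.filter (fun I : Finset (Fin (k + 1)) => I.card = n ∧ i₀ ∉ I)).card
      = k.choose n := by
  have h : Finset.univ.filter (fun I : Finset (Fin (k + 1)) => I.card = n ∧ i₀ ∉ I)
      = Finset.powersetCard n (Finset.univ.erase i₀) := by
    ext I
    simp only [Finset.mem_filter, Finset.mem_univ, true_and, Finset.mem_powersetCard,
      Finset.subset_erase, Finset.subset_univ]
    tauto
  rw [h, Finset.card_powersetCard, Finset.card_erase_of_mem (Finset.mem_univ _)]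
  simp

/-- Odd-`N` half of Theorem 3 of the paper: the bound `n(ℓ − n)/(ℓ − 1)` is attained by the
pairing vector which is uniform on the `ℓ − 1` pair sites different from `i₀` (and zero on `i₀`),
together with the uniform superposition of all `n`-element sets of occupied pairs avoiding `i₀`,
the unpaired fermion sitting at pair index `i₀`. -/
theorem pseudoprojector_norm_bound_odd_tight (ℓ n : ℕ) (hℓ : 2 ≤ ℓ) (hn : 1 ≤ n)
    (hnℓ : n ≤ ℓ - 1) (i₀ : Fin ℓ)
    (ξ : Fin ℓ → ℝ)
    (hξ : ∀ m, ξ m = if m = i₀ then 0 else 1 / Real.sqrt ((ℓ : ℝ) - 1))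
    (A : Finset (Fin ℓ) × Fin ℓ → ℝ)
    (hA : ∀ (I : Finset (Fin ℓ)) (i : Fin ℓ),
      A (I, i) = if i = i₀ ∧ I.card = n ∧ i₀ ∉ I
        then 1 / Real.sqrt ((ℓ - 1).choose n) else 0) :
    (∑ m, ξ m ^ 2 = 1) ∧ (∑ p : Finset (Fin ℓ) × Fin ℓ, A p ^ 2 = 1) ∧
      ∑ i : Fin ℓ, ∑ I' ∈ Finset.univ.filter (fun I' : Finset (Fin ℓ) => I'.card = n - 1),
          (∑ m ∈ I'ᶜ, A (insert m I', i) * ξ m) ^ 2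
        = (n : ℝ) * ((ℓ : ℝ) - n) / ((ℓ : ℝ) - 1) := by
  obtain ⟨k, rfl⟩ : ∃ k, ℓ = k + 1 := ⟨ℓ - 1, by omega⟩
  obtain ⟨j, rfl⟩ : ∃ j, n = j + 1 := ⟨n - 1, by omega⟩
  simp only [Nat.add_sub_cancel] at hnℓ hA ⊢
  have hk : (0 : ℝ) < k := by exact_mod_cast (by omega : 0 < k)
  have hC : (0 : ℝ) < (k.choose (j + 1) : ℕ) := by exact_mod_cast Nat.choose_pos hnℓ
  have hk1 : (((k + 1 : ℕ) : ℝ) - 1) = k := by push_cast; ring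
  simp only [hk1] at hξ ⊢
  have hsk : (1 / Real.sqrt (k : ℝ)) ^ 2 = 1 / k := by
    rw [div_pow, Real.sq_sqrt hk.le, one_pow]
  have hsC : (1 / Real.sqrt ((k.choose (j + 1) : ℕ) : ℝ)) ^ 2 = 1 / (k.choose (j + 1) : ℕ) := by
    rw [div_pow, Real.sq_sqrt hC.le, one_pow]
  refine ⟨?_, ?_, ?_⟩
  · have h : ∀ m, ξ m ^ 2 = if m ≠ i₀ then 1 / (k : ℝ) else 0 := by
      intro m
      rw [hξ]
      by_cases hm : m = i₀
      · simp [hm]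
      · simp only [hm, if_false, ne_eq, not_false_eq_true, if_true, hsk]
    simp only [h]
    rw [← Finset.sum_filter, Finset.sum_const, Finset.filter_ne',
      Finset.card_erase_of_mem (Finset.mem_univ _)]
    simp
    field_simp
  · rw [Fintype.sum_prod_type]
    have h : ∀ I : Finset (Fin (k + 1)), ∑ i, A (I, i) ^ 2
        = if I.card = j + 1 ∧ i₀ ∉ I then 1 / ((k.choose (j + 1) : ℕ) : ℝ) else 0 := by
      intro I
      rw [Finset.sum_eq_single i₀]
      · rw [hA]
        by_cases hI : I.card = j + 1 ∧ i₀ ∉ I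
        · rw [if_pos ⟨rfl, hI⟩, if_pos hI, hsC]
        · rw [if_neg (fun h => hI h.2), if_neg hI]; simp
      · intro i _ hi
        rw [hA, if_neg (fun h => hi h.1)]; simp
      · simp
    simp only [h]
    rw [← Finset.sum_filter, Finset.sum_const, aux_card_filter, nsmul_eq_mul]
    field_simp
  · rw [Finset.sum_eq_single i₀]
    · have h : ∀ I ∈ Finset.univ.filter (fun I' : Finset (Fin (k + 1)) => I'.card = j),
          (∑ m ∈ Iᶜ, A (insert m I, i₀) * ξ m) ^ 2
          = if i₀ ∉ I then ((k : ℝ) - j) ^ 2 * (1 / ((k.choose (j + 1) : ℕ) : ℝ)) * (1 / k)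
            else 0 := by
        intro I hI
        have hI : I.card = j := by simpa using hI
        by_cases hi : i₀ ∈ I
        · rw [if_neg (not_not.mpr hi), Finset.sum_eq_zero]
          · simp
          · intro m _
            rw [hA, if_neg (fun h => h.2.2 (Finset.mem_insert_of_mem hi)), zero_mul]
        · rw [if_pos hi]
          have hmem : i₀ ∈ Iᶜ := by simpa using hi
          rw [← Finset.add_sum_erase _ _ hmem, hξ i₀, if_pos rfl, mul_zero, zero_add]
          have h2 : ∀ m ∈ Iᶜ.erase i₀, A (insert m I, i₀) * ξ m
              = 1 / Real.sqrt ((k.choose (j + 1) : ℕ) : ℝ) * (1 / Real.sqrt (k : ℝ)) := by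
            intro m hm
            rw [Finset.mem_erase, Finset.mem_compl] at hm
            rw [hA, hξ, if_neg hm.1, if_pos]
            refine ⟨rfl, ?_, ?_⟩
            · rw [Finset.card_insert_of_notMem hm.2, hI]
            · rw [Finset.mem_insert]
              rintro (h | h)
              · exact hm.1 h.symm
              · exact hi h
          rw [Finset.sum_congr rfl h2, Finset.sum_const, Finset.card_erase_of_mem hmem,
            Finset.card_compl, hI, Fintype.card_fin, nsmul_eq_mul, mul_pow, mul_pow, hsC, hsk]
          have h3 : ((k + 1 - j - 1 : ℕ) : ℝ) = (k : ℝ) - j := by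
            rw [show k + 1 - j - 1 = k - j by omega, Nat.cast_sub (by omega)]
          rw [h3]; ring
      rw [Finset.sum_congr rfl h, ← Finset.sum_filter, Finset.filter_filter, Finset.sum_const,
        aux_card_filter, nsmul_eq_mul]
      have h4 : ((k.choose (j + 1) : ℕ) : ℝ) * (j + 1) = (k.choose j : ℕ) * ((k : ℝ) - j) := by
        have := Nat.choose_succ_right_eq k j
        rw [← Nat.cast_sub (by omega)]
        exact_mod_cast this
      push_cast
      field_simp
      linear_combination (-((k : ℝ) - j)) * h4
    · intro i _ hi
      apply Finset.sum_eq_zero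
      intro I _
      rw [Finset.sum_eq_zero]
      · simp
      · intro m _
        rw [hA, if_neg (fun h => hi h.1), zero_mul]
    · simp
end

section
/- Let ℓ and n be integers with ℓ ≥ 2 and 1 ≤ n ≤ ℓ − 1. Let ξ : Fin ℓ → ℝ satisfy ∑_m ξ_m² = 1, and let A : Finset (Fin ℓ) × Fin ℓ → ℝ satisfy A(I, i) = 0 unless (I.card = n and i ∉ I), together with ∑_{I, i} A(I, i)² = 1. Then ∑_{i} ∑_{I' : I'.card = n−1} ( ∑_{m ∉ I'} A(insert m I', i) · ξ_m )² ≤ 1 + (n − 1) · ∑_{I, i} A(I, i)² · ( ∑_{k ∉ I} ξ_k² ). -/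
/-- Reindexing pairs `(I', m)`, `m ∉ I'`, as pairs `(I, m)`, `m ∈ I`. -/
theorem reindex_insert (ℓ n : ℕ) (hn : 1 ≤ n) (G : Finset (Fin ℓ) → Fin ℓ → ℝ) :
    ∑ I' ∈ Finset.univ.filter (fun I' : Finset (Fin ℓ) => I'.card = n - 1),
        ∑ m ∈ I'ᶜ, G (insert m I') m
      = ∑ I ∈ Finset.univ.filter (fun I : Finset (Fin ℓ) => I.card = n), ∑ m ∈ I, G I m := by
  rw [Finset.sum_sigma', Finset.sum_sigma']
  refine Finset.sum_bij' (fun p _ => ⟨insert p.2 p.1, p.2⟩) (fun p _ => ⟨p.1.erase p.2, p.2⟩)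
    ?_ ?_ ?_ ?_ ?_
  · rintro ⟨I, m⟩ h
    simp only [Finset.mem_sigma, Finset.mem_filter, Finset.mem_univ, true_and,
      Finset.mem_compl] at h ⊢
    refine ⟨?_, Finset.mem_insert_self _ _⟩
    rw [Finset.card_insert_of_notMem h.2]
    omega
  · rintro ⟨I, m⟩ h
    simp only [Finset.mem_sigma, Finset.mem_filter, Finset.mem_univ, true_and,
      Finset.mem_compl] at h ⊢
    refine ⟨?_, Finset.notMem_erase _ _⟩
    rw [Finset.card_erase_of_mem h.2]
    omega
  · rintro ⟨I, m⟩ h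
    simp only [Finset.mem_sigma, Finset.mem_compl] at h
    simp [Finset.erase_insert h.2]
  · rintro ⟨I, m⟩ h
    simp only [Finset.mem_sigma] at h
    simp [Finset.insert_erase h.2]
  · rintro ⟨I, m⟩ h
    rfl

/-- The first Cauchy–Schwarz inequality (eq. ex_val_ineq1) in Appendix A of the paper,
used in the proof of the odd-particle-number pseudoprojector norm bound. -/
theorem ex_val_ineq1 (ℓ n : ℕ) (hℓ : 2 ≤ ℓ) (hn : 1 ≤ n) (hnℓ : n ≤ ℓ - 1)
    (ξ : Fin ℓ → ℝ) (hξ : ∑ m, ξ m ^ 2 = 1)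
    (A : Finset (Fin ℓ) × Fin ℓ → ℝ)
    (hA0 : ∀ (I : Finset (Fin ℓ)) (i : Fin ℓ), ¬ (I.card = n ∧ i ∉ I) → A (I, i) = 0)
    (hA1 : ∑ p : Finset (Fin ℓ) × Fin ℓ, A p ^ 2 = 1) :
    ∑ i : Fin ℓ, ∑ I' ∈ Finset.univ.filter (fun I' : Finset (Fin ℓ) => I'.card = n - 1),
        (∑ m ∈ I'ᶜ, A (insert m I', i) * ξ m) ^ 2
      ≤ 1 + ((n : ℝ) - 1) *
          ∑ p : Finset (Fin ℓ) × Fin ℓ, A p ^ 2 * (∑ k ∈ p.1ᶜ, ξ k ^ 2) := by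
  have key : ∀ i : Fin ℓ,
      ∑ I' ∈ Finset.univ.filter (fun I' : Finset (Fin ℓ) => I'.card = n - 1),
        (∑ m ∈ I'ᶜ, A (insert m I', i) * ξ m) ^ 2
      ≤ ∑ I : Finset (Fin ℓ),
        (A (I, i) ^ 2 + ((n : ℝ) - 1) * (A (I, i) ^ 2 * ∑ k ∈ Iᶜ, ξ k ^ 2)) := by
    intro i
    calc _ ≤ ∑ I' ∈ Finset.univ.filter (fun I' : Finset (Fin ℓ) => I'.card = n - 1),
          ∑ m ∈ I'ᶜ, A (insert m I', i) ^ 2 * ∑ k ∈ ((insert m I').erase m)ᶜ, ξ k ^ 2 := by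
          refine Finset.sum_le_sum fun I' _ => ?_
          refine (Finset.sum_mul_sq_le_sq_mul_sq _ _ _).trans (le_of_eq ?_)
          rw [Finset.sum_mul]
          refine Finset.sum_congr rfl fun m hm => ?_
          rw [Finset.erase_insert (Finset.mem_compl.1 hm)]
      _ = ∑ I ∈ Finset.univ.filter (fun I : Finset (Fin ℓ) => I.card = n),
          ∑ m ∈ I, A (I, i) ^ 2 * ∑ k ∈ (I.erase m)ᶜ, ξ k ^ 2 :=
          reindex_insert ℓ n hn (fun I m => A (I, i) ^ 2 * ∑ k ∈ (I.erase m)ᶜ, ξ k ^ 2)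
      _ = ∑ I ∈ Finset.univ.filter (fun I : Finset (Fin ℓ) => I.card = n),
          (A (I, i) ^ 2 + ((n : ℝ) - 1) * (A (I, i) ^ 2 * ∑ k ∈ Iᶜ, ξ k ^ 2)) := by
          refine Finset.sum_congr rfl fun I hI => ?_
          have hc : I.card = n := (Finset.mem_filter.1 hI).2
          have h1 : ∑ m ∈ I, ∑ k ∈ (I.erase m)ᶜ, ξ k ^ 2
              = ∑ m ∈ I, (ξ m ^ 2 + ∑ k ∈ Iᶜ, ξ k ^ 2) := by
            refine Finset.sum_congr rfl fun m hm => ?_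
            rw [Finset.compl_erase, Finset.sum_insert (by simpa using hm)]
          have h2 := Finset.sum_add_sum_compl I (fun m => ξ m ^ 2)
          rw [hξ] at h2
          rw [← Finset.mul_sum, h1, Finset.sum_add_distrib, Finset.sum_const, hc, nsmul_eq_mul]
          linear_combination (A (I, i) ^ 2) * h2
      _ = _ := by
          refine Finset.sum_subset (Finset.filter_subset _ _) fun I _ hI => ?_
          rw [hA0 I i (fun h => hI (by simpa using h.1))]
          simp
  refine (Finset.sum_le_sum fun i _ => key i).trans (le_of_eq ?_)
  rw [← hA1, Fintype.sum_prod_type_right, Fintype.sum_prod_type_right, Finset.mul_sum,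
    ← Finset.sum_add_distrib]
  refine Finset.sum_congr rfl fun i _ => ?_
  rw [Finset.sum_add_distrib, Finset.mul_sum]
end

section
/- Let ℓ and n be integers with 1 ≤ n ≤ ℓ, let ξ : Fin ℓ → ℝ, and fix m₀ ∈ Fin ℓ. Let M(ξ) be the matrix indexed by n-element subsets of Fin ℓ with entries M(ξ)(I, I) = ∑_{m ∈ I} ξ_m², M(ξ)(I, J) = ξ_m · ξ_{m'} whenever I ≠ J and there exist m ∈ I, m' ∈ J with I \ {m} = J \ {m'}, and M(ξ)(I, J) = 0 otherwise. Define ξ' by ξ'_{m₀} = −ξ_{m₀} and ξ'_m = ξ_m for m ≠ m₀, and let D be the diagonal matrix with D(I, I) = −1 if m₀ ∈ I and D(I, I) = 1 otherwise. Then M(ξ') = D · M(ξ) · D. In particular, since D² = 1, the matrices M(ξ') and M(ξ) are similar and have the same spectrum. -/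
open Matrix

/-- The claim of section 4 of the paper: flipping the sign of a single component `ξ_{m₀}`
of the pairing vector preserves the spectrum of the pseudoprojector matrix `M(ξ)`
(given by eq. Phi_matrix_element), since `M(ξ') = D M(ξ) D` with `D` the diagonal ±1 matrix
that is `−1` exactly on the basis states whose pair set contains `m₀`; moreover `D² = 1`,
so `M(ξ')` and `M(ξ)` are similar. -/
theorem sign_flip_conjugation (ℓ n : ℕ) (hn : 1 ≤ n) (hnℓ : n ≤ ℓ)
    (ξ ξ' : Fin ℓ → ℝ) (m₀ : Fin ℓ)
    (hξ'0 : ξ' m₀ = -ξ m₀) (hξ' : ∀ m : Fin ℓ, m ≠ m₀ → ξ' m = ξ m)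
    (M M' : Matrix {I : Finset (Fin ℓ) // I.card = n} {I : Finset (Fin ℓ) // I.card = n} ℝ)
    -- `M = M(ξ)`, as characterized by eq. Phi_matrix_element:
    (hMdiag : ∀ I : {I : Finset (Fin ℓ) // I.card = n}, M I I = ∑ m ∈ I.val, ξ m ^ 2)
    (hMoff : ∀ I J : {I : Finset (Fin ℓ) // I.card = n}, I ≠ J →
        ∀ m m' : Fin ℓ, m ∈ I.val → m' ∈ J.val → I.val \ {m} = J.val \ {m'} →
          M I J = ξ m * ξ m')
    (hMzero : ∀ I J : {I : Finset (Fin ℓ) // I.card = n}, I ≠ J →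
        (¬ ∃ m ∈ I.val, ∃ m' ∈ J.val, I.val \ {m} = J.val \ {m'}) → M I J = 0)
    -- `M' = M(ξ')`, as characterized by eq. Phi_matrix_element:
    (hM'diag : ∀ I : {I : Finset (Fin ℓ) // I.card = n}, M' I I = ∑ m ∈ I.val, ξ' m ^ 2)
    (hM'off : ∀ I J : {I : Finset (Fin ℓ) // I.card = n}, I ≠ J →
        ∀ m m' : Fin ℓ, m ∈ I.val → m' ∈ J.val → I.val \ {m} = J.val \ {m'} →
          M' I J = ξ' m * ξ' m')
    (hM'zero : ∀ I J : {I : Finset (Fin ℓ) // I.card = n}, I ≠ J →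
        (¬ ∃ m ∈ I.val, ∃ m' ∈ J.val, I.val \ {m} = J.val \ {m'}) → M' I J = 0)
    (D : Matrix {I : Finset (Fin ℓ) // I.card = n} {I : Finset (Fin ℓ) // I.card = n} ℝ)
    (hD : D = Matrix.diagonal fun I : {I : Finset (Fin ℓ) // I.card = n} =>
      if m₀ ∈ I.val then (-1 : ℝ) else 1) :
    M' = D * M * D ∧ D * D = 1 := by
  subst hD
  constructor
  · ext I J
    rw [Matrix.mul_diagonal, Matrix.diagonal_mul]
    by_cases hIJ : I = J
    · subst hIJ
      have hs : ∑ m ∈ I.val, ξ' m ^ 2 = ∑ m ∈ I.val, ξ m ^ 2 := by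
        refine Finset.sum_congr rfl fun m _ => ?_
        by_cases h : m = m₀
        · rw [h, hξ'0]; ring
        · rw [hξ' m h]
      rw [hM'diag, hMdiag, hs]
      split_ifs <;> ring
    · by_cases hex : ∃ m ∈ I.val, ∃ m' ∈ J.val, I.val \ {m} = J.val \ {m'}
      · obtain ⟨m, hm, m', hm', h⟩ := hex
        rw [hM'off I J hIJ m m' hm hm' h, hMoff I J hIJ m m' hm hm' h]
        have hne : m ≠ m' := by
          rintro rfl
          apply hIJ
          apply Subtype.ext
          rw [← Finset.insert_erase hm, ← Finset.insert_erase hm',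
            Finset.erase_eq, Finset.erase_eq, h]
        have key : (m₀ ∈ I.val ∧ m₀ ≠ m) ↔ (m₀ ∈ J.val ∧ m₀ ≠ m') := by
          have := Finset.ext_iff.mp h m₀
          simpa using this
        by_cases h1 : m = m₀
        · subst h1
          have hJ : m ∉ J.val := fun hJ => (key.mpr ⟨hJ, hne⟩).2 rfl
          rw [hξ'0, hξ' m' hne.symm, if_pos hm, if_neg hJ]; ring
        · by_cases h2 : m' = m₀
          · subst h2
            have hI : m' ∉ I.val := fun hI => (key.mp ⟨hI, hne.symm⟩).2 rfl
            rw [hξ'0, hξ' m h1, if_pos hm', if_neg hI]; ring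
          · rw [hξ' m h1, hξ' m' h2]
            have hiff : m₀ ∈ I.val ↔ m₀ ∈ J.val :=
              ⟨fun a => (key.mp ⟨a, Ne.symm h1⟩).1, fun a => (key.mpr ⟨a, Ne.symm h2⟩).1⟩
            by_cases hI : m₀ ∈ I.val
            · rw [if_pos hI, if_pos (hiff.mp hI)]; ring
            · rw [if_neg hI, if_neg (fun a => hI (hiff.mpr a))]; ring
      · rw [hM'zero I J hIJ hex, hMzero I J hIJ hex]; ring
  · rw [Matrix.diagonal_mul_diagonal, ← Matrix.diagonal_one]
    congr 1
    funext I
    split_ifs <;> norm_num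
end
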